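/- Let E be a Banach space over 𝕜 (𝕜 = ℝ or ℂ), I a nonempty index set, 𝔘 an ultrafilter on I, n ≥ 1, and A : E^n → 𝕜 a continuous symmetric n-linear form. Let Ā : ((E)_𝔘)^n → 𝕜 be a continuous n-linear form satisfying: (a) Ā(h_E x_1, …, h_E x_n) = A(x_1, …, x_n) for all x_1, …, x_n ∈ E; and (b) for every 1 ≤ j ≤ n, all x_1, …, x_{j−1} ∈ E, every bounded family y = (y_i)_{i∈I} in E, and all z_{j+1}, …, z_n ∈ (E)_𝔘, Ā(h_E x_1, …, h_E x_{j−1}, q_E y, z_{j+1}, …, z_n) = lim_{i,𝔘} Ā(h_E x_1, …, h_E x_{j−1}, h_E y_i, z_{j+1}, …, z_n). Let M be a finite-dimensional subspace of (E)_𝔘, let z_1, …, z_r ∈ M, let m be a natural number and ε > 0. Then there exist continuous linear operators R_1, …, R_m : M → E with ‖R_l‖ ≤ 1 for all l, such that |A(R_{i_1} z_k, …, R_{i_n} z_k) − Ā(z_k, …, z_k)| < ε for every choice of pairwise distinct indices i_1, …, i_n in {1, …, m} and every k = 1, …, r. -/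

import Mathlib

set_option synthInstance.maxHeartbeats 1000000
set_option maxHeartbeats 1000000

open Filter Topology ENNReal NormedSpace

noncomputable section

variable (𝕜 : Type*) [RCLike 𝕜]

/-- The Banach space `ℓ∞(I, E)` of bounded families in `E` indexed by `I`,
with the supremum norm. -/
abbrev BoundedFamilies (I E : Type*) [NormedAddCommGroup E] : Type _ :=
  lp (fun _ : I => E) ⊤

/-- The constant family `(x)_{i ∈ I}`, as an element of `ℓ∞(I, E)`. -/
def constFamily (I : Type*) {E : Type*} [NormedAddCommGroup E] (x : E) :
    BoundedFamilies I E :=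
  ⟨fun _ => x, memℓp_infty ⟨‖x‖, by rintro r ⟨i, rfl⟩; exact le_rfl⟩⟩

/-- The subspace `N_𝔘 = {x ∈ ℓ∞(I,E) : lim_{i,𝔘} ‖x_i‖ = 0}`. -/
def ultraNullSubmodule (I : Type*) (𝔘 : Ultrafilter I) (E : Type*) [NormedAddCommGroup E]
    [NormedSpace 𝕜 E] : Submodule 𝕜 (BoundedFamilies I E) where
  carrier := {x | Tendsto (fun i => ‖x i‖) (𝔘 : Filter I) (𝓝 0)}
  zero_mem' := by
    simpa [lp.coeFn_zero] using (tendsto_const_nhds :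
      Tendsto (fun _ : I => (0 : ℝ)) (𝔘 : Filter I) (𝓝 0))
  add_mem' := by
    intro x y hx hy
    refine squeeze_zero (fun i => norm_nonneg _) (fun i => ?_) (by simpa using hx.add hy)
    have : (↑(x + y) : ∀ _ : I, _) = fun i => x i + y i := by
      rw [lp.coeFn_add]; rfl
    rw [this]
    exact norm_add_le _ _
  smul_mem' := by
    intro c x hx
    have h := hx.const_mul ‖c‖
    refine squeeze_zero (fun i => norm_nonneg _) (fun i => ?_) (by simpa using h)
    have : (↑(c • x) : ∀ _ : I, _) = fun i => c • x i := by
      rw [lp.coeFn_smul]; rfl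
    rw [this]
    simp [norm_smul]

/-- The ultrapower `(E)_𝔘 = ℓ∞(I,E) / N_𝔘`, with the quotient norm. -/
abbrev Ultrapower (I : Type*) (𝔘 : Ultrafilter I) (E : Type*) [NormedAddCommGroup E]
    [NormedSpace 𝕜 E] : Type _ :=
  BoundedFamilies I E ⧸ ultraNullSubmodule 𝕜 I 𝔘 E

/-- The quotient map `q_E : ℓ∞(I,E) → (E)_𝔘`. -/
def ultrapowerQuot (I : Type*) (𝔘 : Ultrafilter I) (E : Type*) [NormedAddCommGroup E]
    [NormedSpace 𝕜 E] (x : BoundedFamilies I E) : Ultrapower 𝕜 I 𝔘 E :=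
  Submodule.Quotient.mk (p := ultraNullSubmodule 𝕜 I 𝔘 E) x

/-- The canonical embedding `h_E : E → (E)_𝔘`, sending `x` to the class of the
constant family `(x)_{i ∈ I}`. -/
def diagonalEmbedding (I : Type*) (𝔘 : Ultrafilter I) (E : Type*) [NormedAddCommGroup E]
    [NormedSpace 𝕜 E] (x : E) : Ultrapower 𝕜 I 𝔘 E :=
  ultrapowerQuot 𝕜 I 𝔘 E (constFamily I x)

/-- `Abar` is the *iterated extension* of the continuous `n`-linear form `A` to the
ultrapower `(E)_𝔘`: it agrees with `A` on (the image under `h_E` of) `E`, and it is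
obtained by iterated limits along `𝔘`, one variable at a time, from the last variable
to the first. -/
def IsIteratedExtension {𝕜 : Type*} [RCLike 𝕜] {I : Type*} {𝔘 : Ultrafilter I}
    {E : Type*} [NormedAddCommGroup E] [NormedSpace 𝕜 E] {n : ℕ}
    (A : ContinuousMultilinearMap 𝕜 (fun _ : Fin n => E) 𝕜)
    (Abar : ContinuousMultilinearMap 𝕜 (fun _ : Fin n => Ultrapower 𝕜 I 𝔘 E) 𝕜) : Prop :=
  (∀ x : Fin n → E, Abar (fun j => diagonalEmbedding 𝕜 I 𝔘 E (x j)) = A x) ∧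
  (∀ (j : Fin n) (x : Fin n → E) (y : BoundedFamilies I E)
      (z : Fin n → Ultrapower 𝕜 I 𝔘 E),
    Tendsto
      (fun i => Abar (fun l => if l < j then diagonalEmbedding 𝕜 I 𝔘 E (x l)
        else if l = j then diagonalEmbedding 𝕜 I 𝔘 E (y i) else z l))
      (𝔘 : Filter I)
      (𝓝 (Abar (fun l => if l < j then diagonalEmbedding 𝕜 I 𝔘 E (x l)
        else if l = j then ultrapowerQuot 𝕜 I 𝔘 E y else z l))))

lemma eventually_norm_apply_lt {𝕜 : Type*} [RCLike 𝕜] {I : Type*} {𝔘 : Ultrafilter I}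
    {E : Type*} [NormedAddCommGroup E] [NormedSpace 𝕜 E] {y : BoundedFamilies I E} {t : ℝ}
    (h : ‖ultrapowerQuot 𝕜 I 𝔘 E y‖ < t) : ∀ᶠ i in (𝔘 : Filter I), ‖y i‖ < t := by
  obtain ⟨s, hs, hst⟩ := exists_between h
  obtain ⟨w, hw, hwn⟩ := Submodule.Quotient.norm_mk_lt (ultrapowerQuot 𝕜 I 𝔘 E y) (sub_pos.2 hs)
  have hmem : y - w ∈ ultraNullSubmodule 𝕜 I 𝔘 E :=
    (Submodule.Quotient.eq (ultraNullSubmodule 𝕜 I 𝔘 E)).1 hw.symm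
  have hlim : Tendsto (fun i => ‖(y - w) i‖) (𝔘 : Filter I) (𝓝 0) := hmem
  filter_upwards [hlim.eventually (gt_mem_nhds (sub_pos.2 hst))] with i hi
  have h₁ : ‖y i - w i‖ < t - s := hi
  have h₂ : ‖w i‖ ≤ ‖w‖ := lp.norm_apply_le_norm ENNReal.top_ne_zero w i
  have h₃ : ‖y i‖ ≤ ‖y i - w i‖ + ‖w i‖ := norm_le_norm_sub_add _ _
  linarith

lemma isClosed_ultraNullSubmodule (𝕜 : Type*) [RCLike 𝕜] (I : Type*) (𝔘 : Ultrafilter I)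
    (E : Type*) [NormedAddCommGroup E] [NormedSpace 𝕜 E] :
    IsClosed (ultraNullSubmodule 𝕜 I 𝔘 E : Set (BoundedFamilies I E)) := by
  refine isClosed_of_closure_subset fun y hy => ?_
  have h₀ : ‖ultrapowerQuot 𝕜 I 𝔘 E y‖ = 0 :=
    (QuotientAddGroup.norm_mk_eq_zero_iff_mem_closure
      (S := (ultraNullSubmodule 𝕜 I 𝔘 E).toAddSubgroup)).2 hy
  refine Metric.tendsto_nhds.2 fun δ hδ => ?_
  filter_upwards [eventually_norm_apply_lt (h₀.trans_lt hδ)] with i hi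
  simpa using hi

/-- A contracted linear lifting of a finite-dimensional subspace of the ultrapower is, along the
ultrafilter, given by operators of norm at most one. -/
lemma exists_lifting_norm_le_one {𝕜 : Type*} [RCLike 𝕜] {I : Type*} {𝔘 : Ultrafilter I}
    {E : Type*} [NormedAddCommGroup E] [NormedSpace 𝕜 E]
    (M : Submodule 𝕜 (Ultrapower 𝕜 I 𝔘 E)) [FiniteDimensional 𝕜 M]
    {c : ℝ} (hc₀ : 0 < c) (hc₁ : c < 1) :
    ∃ (S : I → (M →L[𝕜] E)) (T : M → BoundedFamilies I E),
      (∀ i x, T x i = S i x) ∧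
      (∀ x, ultrapowerQuot 𝕜 I 𝔘 E (T x) = (c : 𝕜) • (x : Ultrapower 𝕜 I 𝔘 E)) ∧
      ∀ᶠ i in (𝔘 : Filter I), ‖S i‖ ≤ 1 := by
  have := isClosed_ultraNullSubmodule 𝕜 I 𝔘 E
  have : ProperSpace M := FiniteDimensional.proper 𝕜 M
  obtain ⟨g, hg⟩ := (ultraNullSubmodule 𝕜 I 𝔘 E).mkQ.exists_rightInverse_of_surjective
    (LinearMap.range_eq_top.2 (Submodule.mkQ_surjective _))
  let L : M →L[𝕜] BoundedFamilies I E := LinearMap.toContinuousLinearMap (g ∘ₗ M.subtype)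
  have hL : ∀ x : M, ultrapowerQuot 𝕜 I 𝔘 E (L x) = x := fun x => LinearMap.congr_fun hg _
  have hcn : ‖(c : 𝕜)‖ = c := by rw [RCLike.norm_ofReal, abs_of_pos hc₀]
  let S : I → (M →L[𝕜] E) := fun i => (c : 𝕜) • (lp.evalCLM 𝕜 (fun _ : I => E) ⊤ i).comp L
  have hS : ∀ i x, S i x = (c : 𝕜) • L x i := fun i x => rfl
  refine ⟨S, fun x => (c : 𝕜) • L x, fun i x => rfl, fun x => ?_, ?_⟩
  · conv_rhs => rw [← hL x]
    rfl
  have key : ∀ x ∈ Metric.closedBall (0 : M) 1,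
      {p : I × M | ‖L p.2 p.1‖ < c⁻¹} ∈ (𝔘 : Filter I) ×ˢ 𝓝 x := by
    intro x hx
    have hx' : ‖ultrapowerQuot 𝕜 I 𝔘 E (L x)‖ < c⁻¹ := by
      rw [hL]
      exact lt_of_le_of_lt (by simpa using hx) ((one_lt_inv₀ hc₀).2 hc₁)
    obtain ⟨t, ht, htc⟩ := exists_between hx'
    have hnear : ∀ᶠ x' in 𝓝 x, ‖L x' - L x‖ < c⁻¹ - t := by
      have := Metric.tendsto_nhds.1 (L.continuous.tendsto x) _ (sub_pos.2 htc)
      simpa only [dist_eq_norm] using this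
    filter_upwards [(eventually_norm_apply_lt ht).prod_mk hnear] with p hp
    have h₁ : ‖L p.2 p.1 - L x p.1‖ ≤ ‖L p.2 - L x‖ :=
      lp.norm_apply_le_norm ENNReal.top_ne_zero (L p.2 - L x) p.1
    have h₂ : ‖L p.2 p.1‖ ≤ ‖L p.2 p.1 - L x p.1‖ + ‖L x p.1‖ := norm_le_norm_sub_add _ _
    have h₃ := hp.1
    have h₄ := hp.2
    exact lt_of_le_of_lt h₂ (by linarith)
  have hK := (isCompact_closedBall (0 : M) 1).mem_prod_nhdsSet_of_forall key
  obtain ⟨U, hU, V, hV, hUV⟩ := Filter.mem_prod_iff.1 hK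
  filter_upwards [hU] with i hi
  refine ContinuousLinearMap.opNorm_le_of_unit_norm zero_le_one fun x hx => ?_
  have hxV : x ∈ V := subset_of_mem_nhdsSet hV (by simp [hx])
  have hlt : ‖L x i‖ < c⁻¹ := hUV (Set.mk_mem_prod hi hxV)
  rw [hS, norm_smul, hcn]
  calc c * ‖L x i‖ ≤ c * c⁻¹ := by gcongr
    _ = 1 := mul_inv_cancel₀ hc₀.ne'

lemma exists_list_forall_sublist {α : Type*} {F : Filter α} [F.NeBot] {P : List α → Prop}
    (h₀ : P []) (h : ∀ l, P l → ∀ᶠ a in F, P (l ++ [a])) (m : ℕ) :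
    ∃ L : List α, L.length = m ∧ ∀ l, l.Sublist L → P l := by
  induction m with
  | zero => exact ⟨[], rfl, fun l hl => by rwa [List.sublist_nil.1 hl]⟩
  | succ m ih =>
    obtain ⟨L, hL, hP⟩ := ih
    have hev : ∀ᶠ a in F, ∀ l ∈ {l | l ∈ L.sublists}, P (l ++ [a]) :=
      (Filter.eventually_all_finite (List.finite_toSet _)).2 fun l hl =>
        h l (hP l (List.mem_sublists.1 hl))
    obtain ⟨a, ha⟩ := hev.exists
    refine ⟨L ++ [a], by simp [hL], fun l hl => ?_⟩
    obtain ⟨l₁, l₂, rfl, h₁, h₂⟩ := List.sublist_append_iff.1 hl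
    rcases List.sublist_singleton.1 h₂ with rfl | rfl
    · simpa using hP l₁ h₁
    · exact ha l₁ (List.mem_sublists.2 h₁)

lemma List.ofFn_getElem_sublist {α : Type*} {n : ℕ} (L : List α) {f : Fin n → Fin L.length}
    (hf : StrictMono f) : (List.ofFn fun j => L[f j]).Sublist L := by
  refine List.sublist_iff_exists_fin_orderEmbedding_get_eq.2
    ⟨OrderEmbedding.ofStrictMono (fun j => f (j.cast (List.length_ofFn))) ?_, ?_⟩
  · exact fun a b hab => hf hab
  · intro j
    simp [Fin.cast]

theorem exists_norm_le_one_operators_approximating_iteratedExtension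
    (𝕜 : Type*) [RCLike 𝕜] (I : Type*) [Nonempty I] (𝔘 : Ultrafilter I)
    (E : Type*) [NormedAddCommGroup E] [NormedSpace 𝕜 E] [CompleteSpace E]
    (n : ℕ) (hn : 1 ≤ n)
    (A : ContinuousMultilinearMap 𝕜 (fun _ : Fin n => E) 𝕜)
    (hsymm : ∀ (σ : Equiv.Perm (Fin n)) (v : Fin n → E), A (fun j => v (σ j)) = A v)
    (Abar : ContinuousMultilinearMap 𝕜 (fun _ : Fin n => Ultrapower 𝕜 I 𝔘 E) 𝕜)
    (hAbar : IsIteratedExtension A Abar)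
    (M : Submodule 𝕜 (Ultrapower 𝕜 I 𝔘 E)) [FiniteDimensional 𝕜 M]
    (r : ℕ) (z : Fin r → M) (m : ℕ) (ε : ℝ) (hε : 0 < ε) :
    ∃ R : Fin m → (M →L[𝕜] E),
      (∀ l, ‖R l‖ ≤ 1) ∧
      ∀ f : Fin n → Fin m, Function.Injective f → ∀ k : Fin r,
        ‖A (fun j => R (f j) (z k)) - Abar (fun _ => (z k : Ultrapower 𝕜 I 𝔘 E))‖ < ε := by
  have hc : ∃ c : ℝ, (0 < c ∧ c < 1) ∧ ∀ k : Fin r,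
      ‖Abar (fun _ => (c : 𝕜) • (z k : Ultrapower 𝕜 I 𝔘 E)) -
        Abar (fun _ => (z k : Ultrapower 𝕜 I 𝔘 E))‖ < ε := by
    have hev : ∀ k : Fin r, ∀ᶠ c : ℝ in 𝓝[<] 1,
        ‖Abar (fun _ => (c : 𝕜) • (z k : Ultrapower 𝕜 I 𝔘 E)) -
          Abar (fun _ => (z k : Ultrapower 𝕜 I 𝔘 E))‖ < ε := by
      intro k
      have hcont : Continuous fun c : ℝ =>
          ‖Abar (fun _ => (c : 𝕜) • (z k : Ultrapower 𝕜 I 𝔘 E)) -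
            Abar (fun _ => (z k : Ultrapower 𝕜 I 𝔘 E))‖ :=
        ((Abar.cont.comp (continuous_pi fun _ : Fin n =>
          (RCLike.continuous_ofReal (K := 𝕜)).smul
            (continuous_const (y := (z k : Ultrapower 𝕜 I 𝔘 E))))).sub continuous_const).norm
      refine (hcont.tendsto' 1 0 ?_).mono_left nhdsWithin_le_nhds |>.eventually (gt_mem_nhds hε)
      simp
    have hIoo : ∀ᶠ c : ℝ in 𝓝[<] 1, 0 < c ∧ c < 1 := Ioo_mem_nhdsLT zero_lt_one
    exact (hIoo.and (eventually_all.2 hev)).exists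
  obtain ⟨c, ⟨hc₀, hc₁⟩, hcε⟩ := hc
  obtain ⟨S, T, hTS, hT, hS⟩ := exists_lifting_norm_le_one M hc₀ hc₁
  let v : List I → Fin r → Fin n → Ultrapower 𝕜 I 𝔘 E := fun l k j =>
    if h : (j : ℕ) < l.length then diagonalEmbedding 𝕜 I 𝔘 E (S l[j] (z k))
    else (c : 𝕜) • (z k : Ultrapower 𝕜 I 𝔘 E)
  let P : List I → Prop := fun l => (∀ i ∈ l, ‖S i‖ ≤ 1) ∧ (l.length ≤ n → ∀ k,
    ‖Abar (v l k) - Abar (fun _ => (z k : Ultrapower 𝕜 I 𝔘 E))‖ < ε)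
  have hP₀ : P [] := ⟨by simp, fun _ k => by simpa [v] using hcε k⟩
  have hP : ∀ l, P l → ∀ᶠ i in (𝔘 : Filter I), P (l ++ [i]) := by
    rintro l ⟨hl₁, hl₂⟩
    have hnorm : ∀ᶠ i in (𝔘 : Filter I), ∀ a ∈ l ++ [i], ‖S a‖ ≤ 1 := by
      filter_upwards [hS] with i hi a ha
      rcases List.mem_append.1 ha with ha | ha
      · exact hl₁ a ha
      · rwa [List.mem_singleton.1 ha]
    refine hnorm.and ?_
    rcases lt_or_ge l.length n with hln | hln
    swap
    · exact Eventually.of_forall fun i hi => by simp at hi; omega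
    have hclose : ∀ k, ∀ᶠ i in (𝔘 : Filter I),
        ‖Abar (v (l ++ [i]) k) - Abar (fun _ => (z k : Ultrapower 𝕜 I 𝔘 E))‖ < ε := by
      intro k
      have hlim := hAbar.2 ⟨l.length, hln⟩
        (fun j => if h : (j : ℕ) < l.length then S l[j] (z k) else 0) (T (z k))
        (fun _ => (c : 𝕜) • (z k : Ultrapower 𝕜 I 𝔘 E))
      have hlim' : Tendsto (fun i => Abar (v (l ++ [i]) k)) (𝔘 : Filter I) (𝓝 (Abar (v l k))) := by
        convert hlim using 3 with i
        · funext j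
          rcases lt_trichotomy (j : ℕ) l.length with h | h | h
          · have h' : (j : ℕ) < l.length + 1 := by omega
            simp [v, Fin.lt_def, h, h', List.getElem_append_left]
          · simp [v, Fin.lt_def, Fin.ext_iff, h, hTS]
          · have h' : ¬ (j : ℕ) < l.length + 1 := by omega
            simp [v, Fin.lt_def, Fin.ext_iff, h.not_gt, h.ne', h']
        · funext j
          rcases lt_trichotomy (j : ℕ) l.length with h | h | h
          · simp [v, Fin.lt_def, h]
          · simp [v, Fin.lt_def, Fin.ext_iff, h, hT]
          · simp [v, Fin.lt_def, Fin.ext_iff, h.not_gt, h.ne']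
      exact (hlim'.sub_const _).norm.eventually_lt_const (hl₂ hln.le k)
    filter_upwards [eventually_all.2 hclose] with i hi _ using hi
  obtain ⟨L, rfl, hL⟩ := exists_list_forall_sublist hP₀ hP m
  refine ⟨fun a => S L[a], fun a => (hL L (List.Sublist.refl L)).1 _ (List.getElem_mem _),
    fun f hf k => ?_⟩
  have hmono : StrictMono (f ∘ Tuple.sort f) :=
    (Tuple.monotone_sort f).strictMono_of_injective (hf.comp (Tuple.sort f).injective)
  have hlt := (hL _ (List.ofFn_getElem_sublist L hmono)).2 (by simp) k
  rw [← hsymm (Tuple.sort f), ← hAbar.1]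
  convert hlt using 4
  simp [v]
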